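/- (Key inequality in Theorem 2 of the paper.) For every vertex t of a finite undirected simple graph in which every vertex has degree at least one, the PageRank value satisfies n·π(t)/d_t ≥ α·√(2(1-α)/m); equivalently, π(t) ≥ (α·d_t/n)·√(2(1-α)/m). -/

import Mathlib

open Matrix Finset

noncomputable def transP {V : Type*} [Fintype V] [DecidableEq V]
    (G : SimpleGraph V) [DecidableRel G.Adj] : Matrix V V ℝ :=
  G.adjMatrix ℝ * (Matrix.diagonal fun u : V => (G.degree u : ℝ))⁻¹

noncomputable def pagerank {V : Type*} [Fintype V] [DecidableEq V]
    (G : SimpleGraph V) [DecidableRel G.Adj] (α : ℝ) : V → ℝ :=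
  ∑' i : ℕ, (α * (1 - α) ^ i) • ((transP G ^ i) *ᵥ fun _ : V => 1 / (Fintype.card V : ℝ))

noncomputable def pprHop {V : Type*} [Fintype V] [DecidableEq V]
    (G : SimpleGraph V) [DecidableRel G.Adj] (α : ℝ) (s : V) (ℓ : ℕ) : V → ℝ :=
  (α * (1 - α) ^ ℓ) • ((transP G ^ ℓ) *ᵥ Pi.single s 1)

noncomputable def ppr {V : Type*} [Fintype V] [DecidableEq V]
    (G : SimpleGraph V) [DecidableRel G.Adj] (α : ℝ) (s : V) : V → ℝ :=
  ∑' ℓ : ℕ, pprHop G α s ℓ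

section PageRank

variable {V : Type*} [Fintype V] [DecidableEq V] (G : SimpleGraph V) [DecidableRel G.Adj]

theorem transP_apply (hdeg : ∀ u : V, 1 ≤ G.degree u) (u v : V) :
    transP G u v = G.adjMatrix ℝ u v * (G.degree v : ℝ)⁻¹ := by
  have hinv : (Matrix.diagonal fun u : V => (G.degree u : ℝ))⁻¹ =
      Matrix.diagonal fun u : V => (G.degree u : ℝ)⁻¹ := by
    apply Matrix.inv_eq_left_inv
    rw [Matrix.diagonal_mul_diagonal, ← Matrix.diagonal_one]
    congr 1
    funext u
    have : (G.degree u : ℝ) ≠ 0 := by have := hdeg u; positivity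
    exact inv_mul_cancel₀ this
  rw [transP, hinv, Matrix.mul_diagonal]

theorem transP_nonneg (hdeg : ∀ u : V, 1 ≤ G.degree u) (u v : V) : 0 ≤ transP G u v := by
  rw [transP_apply G hdeg, SimpleGraph.adjMatrix_apply]
  split_ifs <;> positivity

theorem sum_transP_column (hdeg : ∀ u : V, 1 ≤ G.degree u) (v : V) :
    ∑ u, transP G u v = 1 := by
  have hv : (G.degree v : ℝ) ≠ 0 := by have := hdeg v; positivity
  simp_rw [transP_apply G hdeg, ← Finset.sum_mul, SimpleGraph.adjMatrix_apply, G.adj_comm _ v]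
  rw [Finset.sum_boole, ← SimpleGraph.neighborFinset_eq_filter,
    SimpleGraph.card_neighborFinset_eq_degree, mul_inv_cancel₀ hv]

theorem transP_pow_mulVec_nonneg (hdeg : ∀ u : V, 1 ≤ G.degree u) {x : V → ℝ}
    (hx : ∀ u, 0 ≤ x u) (i : ℕ) (u : V) : 0 ≤ ((transP G ^ i) *ᵥ x) u := by
  induction i generalizing u with
  | zero => simpa using hx u
  | succ k ih =>
    rw [pow_succ', ← Matrix.mulVec_mulVec]
    exact Finset.sum_nonneg fun v _ => mul_nonneg (transP_nonneg G hdeg u v) (ih v)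

theorem sum_transP_pow_mulVec (hdeg : ∀ u : V, 1 ≤ G.degree u) (x : V → ℝ) (i : ℕ) :
    ∑ u, ((transP G ^ i) *ᵥ x) u = ∑ u, x u := by
  induction i with
  | zero => simp
  | succ k ih =>
    rw [pow_succ', ← Matrix.mulVec_mulVec, ← ih]
    simp only [Matrix.mulVec, dotProduct]
    rw [Finset.sum_comm]
    simp_rw [← Finset.sum_mul, sum_transP_column G hdeg, one_mul]

theorem summable_pagerank_series (hdeg : ∀ u : V, 1 ≤ G.degree u) {α : ℝ} (hα0 : 0 < α)
    (hα1 : α < 1) {x : V → ℝ} (hx : ∀ u, 0 ≤ x u) :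
    Summable fun i : ℕ => (α * (1 - α) ^ i) • ((transP G ^ i) *ᵥ x) := by
  have h1 : 0 < 1 - α := by linarith
  rw [Pi.summable]
  intro u
  refine Summable.of_nonneg_of_le (f := fun i : ℕ => (1 - α) ^ i * (α * ∑ u, x u))
    (fun i => ?_) (fun i => ?_)
    ((summable_geometric_of_lt_one h1.le (by linarith)).mul_right _)
  · exact mul_nonneg (by positivity) (transP_pow_mulVec_nonneg G hdeg hx i u)
  · have hle : ((transP G ^ i) *ᵥ x) u ≤ ∑ u, x u := by
      rw [← sum_transP_pow_mulVec G hdeg x i]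
      exact Finset.single_le_sum (fun v _ => transP_pow_mulVec_nonneg G hdeg hx i v)
        (Finset.mem_univ u)
    calc α * (1 - α) ^ i * ((transP G ^ i) *ᵥ x) u
        ≤ α * (1 - α) ^ i * ∑ u, x u := by gcongr
      _ = (1 - α) ^ i * (α * ∑ u, x u) := by ring

theorem pagerank_ge_two_terms (hdeg : ∀ u : V, 1 ≤ G.degree u) {α : ℝ} (hα0 : 0 < α)
    (hα1 : α < 1) (t : V) :
    α / (Fintype.card V : ℝ) *
      (1 + (1 - α) * ∑ v ∈ G.neighborFinset t, (G.degree v : ℝ)⁻¹) ≤ pagerank G α t := by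
  have h1 : 0 < 1 - α := by linarith
  have hx : ∀ _ : V, (0 : ℝ) ≤ 1 / (Fintype.card V : ℝ) := fun _ => by positivity
  have hs := summable_pagerank_series G hdeg hα0 hα1 hx
  rw [pagerank, tsum_apply hs]
  refine le_trans (le_of_eq ?_) ((Pi.summable.mp hs t).sum_le_tsum (Finset.range 2)
    fun i _ => mul_nonneg (by positivity) (transP_pow_mulVec_nonneg G hdeg hx i t))
  have hstep : (transP G *ᵥ fun _ : V => 1 / (Fintype.card V : ℝ)) t =
      (∑ v ∈ G.neighborFinset t, (G.degree v : ℝ)⁻¹) * (1 / (Fintype.card V : ℝ)) := by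
    simp only [Matrix.mulVec, dotProduct, transP_apply G hdeg, Finset.sum_mul,
      SimpleGraph.adjMatrix_apply, ite_mul, one_mul, zero_mul,
      SimpleGraph.neighborFinset_eq_filter, Finset.sum_filter]
  simp only [Finset.sum_range_succ, Finset.sum_range_zero, zero_add, pow_zero, pow_one,
    Matrix.one_mulVec, Pi.smul_apply, smul_eq_mul, hstep]
  ring

end PageRank

theorem degree_sq_le_edges_mul_sum_inv {V : Type*} [Fintype V] (G : SimpleGraph V)
    [DecidableRel G.Adj] (hdeg : ∀ u : V, 1 ≤ G.degree u) (t : V) :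
    (G.degree t : ℝ) ^ 2 ≤
      2 * (G.edgeFinset.card : ℝ) * ∑ v ∈ G.neighborFinset t, (G.degree v : ℝ)⁻¹ := by
  have hcs := Finset.sum_sq_le_sum_mul_sum_of_sq_le_mul (G.neighborFinset t)
    (r := fun _ => (1 : ℝ)) (f := fun v => (G.degree v : ℝ)) (g := fun v => (G.degree v : ℝ)⁻¹)
    (fun _ _ => by positivity) (fun _ _ => by positivity) (fun v _ => by
      have : (G.degree v : ℝ) ≠ 0 := by have := hdeg v; positivity
      rw [one_pow, mul_inv_cancel₀ this])
  have hsum : ∑ v ∈ G.neighborFinset t, (G.degree v : ℝ) ≤ 2 * (G.edgeFinset.card : ℝ) := by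
    calc ∑ v ∈ G.neighborFinset t, (G.degree v : ℝ) ≤ ∑ v, (G.degree v : ℝ) :=
          Finset.sum_le_sum_of_subset_of_nonneg (Finset.subset_univ _)
            fun _ _ _ => by positivity
      _ = 2 * (G.edgeFinset.card : ℝ) := by exact_mod_cast G.sum_degrees_eq_twice_card_edges
  rw [Finset.sum_const, SimpleGraph.card_neighborFinset_eq_degree, nsmul_eq_mul, mul_one] at hcs
  exact hcs.trans (by gcongr)

theorem pagerank_sqrt_lower_bound
    {V : Type*} [Fintype V] [DecidableEq V] [Nonempty V]
    (G : SimpleGraph V) [DecidableRel G.Adj]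
    (hdeg : ∀ u : V, 1 ≤ G.degree u)
    (α : ℝ) (hα0 : 0 < α) (hα1 : α < 1) (t : V) :
    α * Real.sqrt (2 * (1 - α) / (G.edgeFinset.card : ℝ)) ≤
      (Fintype.card V : ℝ) * pagerank G α t / (G.degree t : ℝ) ∧
    (α * (G.degree t : ℝ) / (Fintype.card V : ℝ)) *
        Real.sqrt (2 * (1 - α) / (G.edgeFinset.card : ℝ)) ≤ pagerank G α t := by
  have h1 : 0 < 1 - α := by linarith
  have hn : (0 : ℝ) < Fintype.card V := by exact_mod_cast Fintype.card_pos
  have hd : (0 : ℝ) < G.degree t := by exact_mod_cast hdeg t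
  have hπ := pagerank_ge_two_terms G hdeg hα0 hα1 t
  have hS := degree_sq_le_edges_mul_sum_inv G hdeg t
  set S := ∑ v ∈ G.neighborFinset t, (G.degree v : ℝ)⁻¹
  set m : ℝ := (G.edgeFinset.card : ℝ) with hm_def
  set d : ℝ := (G.degree t : ℝ)
  clear_value S
  have hm : 0 < m := lt_of_le_of_ne (by positivity) fun h => by
    rw [← h] at hS
    nlinarith [pow_pos hd 2]
  have hdS : d ^ 2 / (2 * m) ≤ S := by
    rw [div_le_iff₀ (by positivity)]
    linarith
  have hS0 : 0 ≤ S := le_trans (by positivity) hdS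
  have hamgm : d * Real.sqrt (2 * (1 - α) / m) ≤ 1 + (1 - α) * S := by
    refine le_of_abs_le (abs_le_of_sq_le_sq ?_ (by positivity))
    rw [mul_pow, Real.sq_sqrt (by positivity)]
    have hkey : d ^ 2 * (2 * (1 - α) / m) = 4 * ((1 - α) * (d ^ 2 / (2 * m))) := by
      field_simp
      ring
    rw [hkey]
    nlinarith [sq_nonneg (1 - (1 - α) * S), mul_le_mul_of_nonneg_left hdS h1.le]
  have hmain : α * d / Fintype.card V * Real.sqrt (2 * (1 - α) / m) ≤ pagerank G α t := by
    calc α * d / Fintype.card V * Real.sqrt (2 * (1 - α) / m)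
        = α / Fintype.card V * (d * Real.sqrt (2 * (1 - α) / m)) := by ring
      _ ≤ α / Fintype.card V * (1 + (1 - α) * S) := by gcongr
      _ ≤ pagerank G α t := hπ
  refine ⟨?_, hmain⟩
  rw [le_div_iff₀ hd]
  calc α * Real.sqrt (2 * (1 - α) / m) * d
      = Fintype.card V * (α * d / Fintype.card V * Real.sqrt (2 * (1 - α) / m)) := by
        field_simp
    _ ≤ Fintype.card V * pagerank G α t := by gcongr
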